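/- arXiv:1009.2058 — 2 statements merged into one kernel-verified Lean document; each statement's English description precedes it below -/
import Mathlib

section
/- Assume the jump-free theorem. Let G = (N^k, Θ) be a downward directed lattice graph and let p be a positive integer. Then there exist a finite set D ⊆ N^k and a set E ⊆ N with |E| = p and E^k ⊆ D such that the terminal label function t_D is regressively regular over E^k; in particular, the set of t_D-significant labels {t_D(z) : z ∈ E^k, t_D(z) < min(z)} has cardinality at most k^k. -/
namespace LatticeMultiverse

/-- Maximum coordinate value of a lattice point `x ∈ ℕ^k`. -/
noncomputable def vmax {k : ℕ} (x : Fin k → ℕ) : ℕ := sSup (Set.range x)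

/-- Minimum coordinate value of a lattice point `x ∈ ℕ^k`. -/
noncomputable def vmin {k : ℕ} (x : Fin k → ℕ) : ℕ := sInf (Set.range x)

/-- `G = (ℕ^k, Θ)` is a downward directed lattice graph:
every edge `(x, y) ∈ Θ` satisfies `max x > max y`. -/
def Downward {k : ℕ} (Θ : Set ((Fin k → ℕ) × (Fin k → ℕ))) : Prop :=
  ∀ e ∈ Θ, vmax e.2 < vmax e.1

/-- A path in the induced subgraph `G_D`: a nonempty list of distinct vertices of `D`
with consecutive pairs being edges of `Θ` (hence of `Θ_D`). -/
def IsPath {k : ℕ} (Θ : Set ((Fin k → ℕ) × (Fin k → ℕ))) (D : Finset (Fin k → ℕ))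
    (l : List (Fin k → ℕ)) : Prop :=
  l ≠ [] ∧ l.Nodup ∧ (∀ x ∈ l, x ∈ D) ∧ l.Chain' (fun a b => (a, b) ∈ Θ)

/-- A terminal path in `G_D`: a path admitting no one-vertex extension. -/
def IsTerminalPath {k : ℕ} (Θ : Set ((Fin k → ℕ) × (Fin k → ℕ))) (D : Finset (Fin k → ℕ))
    (l : List (Fin k → ℕ)) : Prop :=
  IsPath Θ D l ∧ ∀ y, ¬ IsPath Θ D (l ++ [y])

/-- `T_D(z)`: the set of last vertices of terminal paths in `G_D` starting at `z`. -/
def TD {k : ℕ} (Θ : Set ((Fin k → ℕ) × (Fin k → ℕ))) (D : Finset (Fin k → ℕ))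
    (z : Fin k → ℕ) : Set (Fin k → ℕ) :=
  {w | ∃ l, IsTerminalPath Θ D l ∧ l.head? = some z ∧ l.getLast? = some w}

/-- The terminal label function `t_D(z) = min({min x : x ∈ T_D(z)} ∪ {min z})`. -/
noncomputable def tD {k : ℕ} (Θ : Set ((Fin k → ℕ) × (Fin k → ℕ))) (D : Finset (Fin k → ℕ))
    (z : Fin k → ℕ) : ℕ :=
  sInf (vmin '' TD Θ D z ∪ {vmin z})

open Classical in
/-- The relaxed terminal label function `t̂_D`: `max z` if the one-vertex path `(z)` is
terminal in `G_D`, and `t_D z` otherwise. -/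
noncomputable def tDhat {k : ℕ} (Θ : Set ((Fin k → ℕ) × (Fin k → ℕ))) (D : Finset (Fin k → ℕ))
    (z : Fin k → ℕ) : ℕ :=
  if IsTerminalPath Θ D [z] then vmax z else tD Θ D z

/-- Two `k`-tuples have the same order type. -/
def SameOrderType {k : ℕ} (x y : Fin k → ℕ) : Prop :=
  (∀ i j, x i < x j ↔ y i < y j) ∧ (∀ i j, x i = x j ↔ y i = y j)

/-- The cube `E^k ⊆ ℕ^k`. -/
def cube (k : ℕ) (E : Finset ℕ) : Finset (Fin k → ℕ) := Fintype.piFinset fun _ => E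

/-- `f` is regressively regular over `E^k`: for each order type of `k`-tuples,
either `f x ≥ min x` for all `x ∈ E^k` of that order type, or
`f x = f y < min E` for all `x, y ∈ E^k` of that order type. -/
def RegressivelyRegular {k : ℕ} (E : Finset ℕ) (f : (Fin k → ℕ) → ℕ) : Prop :=
  ∀ x ∈ cube k E,
    (∀ y ∈ cube k E, SameOrderType x y → vmin y ≤ f y) ∨
    (∀ y ∈ cube k E, ∀ z ∈ cube k E, SameOrderType x y → SameOrderType x z →
      f y = f z ∧ f y < sInf (E : Set ℕ))

/-- The set of `f`-significant labels of `S`: `{f z : z ∈ S, f z < min z}`. -/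
def sigLabels {k : ℕ} (f : (Fin k → ℕ) → ℕ) (S : Set (Fin k → ℕ)) : Set ℕ :=
  f '' {z ∈ S | f z < vmin z}

/-- A family of functions with finite domains is encoded as a set of pairs `(D, f)`,
`D` the domain.  Full: every finite `D` is the domain of some member. -/
def FullFam {k : ℕ} (Q : Set (Finset (Fin k → ℕ) × ((Fin k → ℕ) → ℕ))) : Prop :=
  ∀ D, ∃ f, (D, f) ∈ Q

/-- Reflexive: each value `f x`, `x ∈ D`, is a coordinate of some `y ∈ D`. -/
def ReflexiveFam {k : ℕ} (Q : Set (Finset (Fin k → ℕ) × ((Fin k → ℕ) → ℕ))) : Prop :=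
  ∀ p ∈ Q, ∀ x ∈ p.1, ∃ y ∈ p.1, ∃ i, p.2 x = y i

/-- Jump-free: if `x ∈ A ∩ B`, `A_x ⊆ B_x` and `f_A = f_B` on `A_x`, then `f_A x ≥ f_B x`. -/
def JumpFreeFam {k : ℕ} (Q : Set (Finset (Fin k → ℕ) × ((Fin k → ℕ) → ℕ))) : Prop :=
  ∀ A ∈ Q, ∀ B ∈ Q, ∀ x, x ∈ A.1 → x ∈ B.1 →
    (∀ z ∈ A.1, vmax z < vmax x → z ∈ B.1) →
    (∀ y ∈ A.1, vmax y < vmax x → A.2 y = B.2 y) →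
    B.2 x ≤ A.2 x

/-- Friedman's jump-free theorem (independent of ZFC), stated as a proposition to be
assumed as a hypothesis: for every full, reflexive, jump-free family `Q` on `ℕ^k` and
every `p > 0` there are a finite `D`, an `E` with `|E| = p` and `E^k ⊆ D`, and an
`f ∈ Q` with domain `D` that is regressively regular over `E^k`. -/
def JumpFreeTheorem (k : ℕ) : Prop :=
  ∀ Q : Set (Finset (Fin k → ℕ) × ((Fin k → ℕ) → ℕ)),
    FullFam Q → ReflexiveFam Q → JumpFreeFam Q →
    ∀ p : ℕ, 0 < p →
      ∃ D E f, (D, f) ∈ Q ∧ E.card = p ∧ cube k E ⊆ D ∧ RegressivelyRegular E f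

/-- `ℱ_G = {F^x_r}` is a family of partial selection functions on the out-neighborhoods
of `G = (ℕ^k, Θ)`: `F x r` is the partial function `F^x_r : (G^x × ℕ)^r ⇀ ℕ`
(`none` = undefined); whenever defined, its value is one of the `n_i`, and its domain
consists of tuples whose first components are out-neighbors of `x`. -/
def IsSelectionFamily {k : ℕ} (Θ : Set ((Fin k → ℕ) × (Fin k → ℕ)))
    (F : (Fin k → ℕ) → (r : ℕ) → (Fin r → (Fin k → ℕ) × ℕ) → Option ℕ) : Prop :=
  ∀ x r args n, F x r args = some n → (∃ i, n = (args i).2) ∧ ∀ i, (x, (args i).1) ∈ Θ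

/-- `Φ^D_x` relative to a labeling `g`: all defined values
`F^x_r((y₁, g y₁), …, (y_r, g y_r))` with `r ≥ 1` and `y₁, …, y_r ∈ G^x_D`. -/
def Phi {k : ℕ} (Θ : Set ((Fin k → ℕ) × (Fin k → ℕ)))
    (F : (Fin k → ℕ) → (r : ℕ) → (Fin r → (Fin k → ℕ) × ℕ) → Option ℕ)
    (D : Finset (Fin k → ℕ)) (g : (Fin k → ℕ) → ℕ) (x : Fin k → ℕ) : Set ℕ :=
  {n | ∃ r, 1 ≤ r ∧ ∃ y : Fin r → (Fin k → ℕ),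
    ∃ _ : ∀ i, y i ∈ D ∧ (x, y i) ∈ Θ,
    F x r (fun i => (y i, g (y i))) = some n}

open Classical in
/-- The selection labeling function `s_D`, defined by recursion on `vmax x`:
`s_D x = min Φ^D_x` if `Φ^D_x ≠ ∅` (where `Φ^D_x = Phi Θ F D (s_D) x`), and
`s_D x = min x` otherwise. -/
noncomputable def sD {k : ℕ} (Θ : Set ((Fin k → ℕ) × (Fin k → ℕ))) (hΘ : Downward Θ)
    (F : (Fin k → ℕ) → (r : ℕ) → (Fin r → (Fin k → ℕ) × ℕ) → Option ℕ)
    (D : Finset (Fin k → ℕ)) (x : Fin k → ℕ) : ℕ :=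
  let Φ : Set ℕ := {n | ∃ r, 1 ≤ r ∧ ∃ y : Fin r → (Fin k → ℕ),
    ∃ _ : ∀ i, y i ∈ D ∧ (x, y i) ∈ Θ,
    F x r (fun i => (y i, sD Θ hΘ F D (y i))) = some n}
  if Φ.Nonempty then sInf Φ else vmin x
termination_by vmax x
decreasing_by
  have h : ∀ i, y i ∈ D ∧ (x, y i) ∈ Θ := by assumption
  exact hΘ _ (h i).2

open Classical in
/-- The relaxed selection labeling function `ŝ_D`: `s_D x` if `Φ^D_x ≠ ∅`,
and `max x` otherwise. -/
noncomputable def sDhat {k : ℕ} (Θ : Set ((Fin k → ℕ) × (Fin k → ℕ))) (hΘ : Downward Θ)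
    (F : (Fin k → ℕ) → (r : ℕ) → (Fin r → (Fin k → ℕ) × ℕ) → Option ℕ)
    (D : Finset (Fin k → ℕ)) (x : Fin k → ℕ) : ℕ :=
  if (Phi Θ F D (sD Θ hΘ F D) x).Nonempty then sD Θ hΘ F D x else vmax x

/-- The maximal downward edge set `Θ = {(x, y) : max x > max y}`. -/
def maxTheta (k : ℕ) : Set ((Fin k → ℕ) × (Fin k → ℕ)) := {e | vmax e.2 < vmax e.1}

theorem maxTheta_downward (k : ℕ) : Downward (maxTheta k) := fun _ he => he

section Coordinates

variable {k : ℕ}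

theorem le_vmax (x : Fin k → ℕ) (i : Fin k) : x i ≤ vmax x :=
  le_csSup (Set.finite_range x).bddAbove ⟨i, rfl⟩

theorem vmin_le (x : Fin k → ℕ) (i : Fin k) : vmin x ≤ x i :=
  Nat.sInf_le ⟨i, rfl⟩

theorem exists_vmax_eq [NeZero k] (x : Fin k → ℕ) : ∃ i, vmax x = x i := by
  obtain ⟨i, hi⟩ := Nat.sSup_mem (Set.range_nonempty x) (Set.finite_range x).bddAbove
  exact ⟨i, hi.symm⟩

theorem exists_vmin_eq [NeZero k] (x : Fin k → ℕ) : ∃ i, vmin x = x i := by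
  obtain ⟨i, hi⟩ := Nat.sInf_mem (Set.range_nonempty x)
  exact ⟨i, hi.symm⟩

theorem vmin_le_vmax [NeZero k] (x : Fin k → ℕ) : vmin x ≤ vmax x :=
  (vmin_le x 0).trans (le_vmax x 0)

/-- The rank tuple of `x`: coordinate `i` counts the coordinates of `x` strictly below `x i`. -/
def rankTuple (x : Fin k → ℕ) (i : Fin k) : Fin k :=
  ⟨(Finset.univ.filter fun j => x j < x i).card, by
    have h : (Finset.univ.filter fun j => x j < x i) ⊂ Finset.univ :=
      Finset.filter_ssubset.2 ⟨i, Finset.mem_univ i, lt_irrefl _⟩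
    simpa using Finset.card_lt_card h⟩

theorem rankTuple_lt_iff (x : Fin k → ℕ) (i j : Fin k) :
    rankTuple x i < rankTuple x j ↔ x i < x j := by
  constructor
  · intro h
    by_contra! hle
    exact absurd (Finset.card_le_card (Finset.monotone_filter_right Finset.univ
      fun m _ (hm : x m < x j) => hm.trans_le hle)) (not_le.2 h)
  · intro h
    simp only [Fin.lt_def, rankTuple]
    refine Finset.card_lt_card (Finset.ssubset_iff_of_subset ?_ |>.2 ⟨i, ?_, ?_⟩)
    · exact Finset.monotone_filter_right Finset.univ fun m _ (hm : x m < x i) => hm.trans h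
    · simpa using h
    · simp

theorem sameOrderType_of_rankTuple_eq {x y : Fin k → ℕ} (h : rankTuple x = rankTuple y) :
    SameOrderType x y := by
  have hlt : ∀ i j, x i < x j ↔ y i < y j := fun i j => by
    rw [← rankTuple_lt_iff x, ← rankTuple_lt_iff y, h]
  refine ⟨hlt, fun i j => ?_⟩
  have h₁ := hlt i j
  have h₂ := hlt j i
  omega

/-- A regressively regular function has at most `k ^ k` significant labels on the cube. -/
theorem RegressivelyRegular.ncard_sigLabels_le {E : Finset ℕ} {f : (Fin k → ℕ) → ℕ}
    (hf : RegressivelyRegular E f) :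
    (sigLabels f (cube k E : Set (Fin k → ℕ))).ncard ≤ k ^ k := by
  have hex : ∀ n : ℕ, ∃ z, n ∈ sigLabels f (cube k E : Set (Fin k → ℕ)) →
      (z ∈ cube k E ∧ f z < vmin z) ∧ f z = n := fun n => by
    by_cases hn : n ∈ sigLabels f (cube k E : Set (Fin k → ℕ))
    · obtain ⟨z, hz, hzn⟩ := hn
      exact ⟨z, fun _ => ⟨hz, hzn⟩⟩
    · exact ⟨0, fun h => absurd h hn⟩
  choose g hg using hex
  have hle := Set.ncard_le_ncard_of_injOn (t := (Set.univ : Set (Fin k → Fin k)))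
    (fun n => rankTuple (g n)) (fun _ _ => Set.mem_univ _) (s := sigLabels f (cube k E)) (by
      intro m hm n hn hmn
      obtain ⟨⟨hmE, hmlt⟩, hmf⟩ := hg m hm
      obtain ⟨⟨hnE, -⟩, hnf⟩ := hg n hn
      have hrefl : SameOrderType (g m) (g m) := ⟨fun _ _ => Iff.rfl, fun _ _ => Iff.rfl⟩
      rcases hf (g m) hmE with h | h
      · exact absurd (h _ hmE hrefl) (not_le.2 hmlt)
      · rw [← hmf, ← hnf]
        exact (h _ hmE _ hnE hrefl (sameOrderType_of_rankTuple_eq hmn)).1) Set.finite_univ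
  simpa [Set.ncard_univ, Nat.card_eq_fintype_card] using hle

end Coordinates

section Terminal

variable {k : ℕ} {Θ : Set ((Fin k → ℕ) × (Fin k → ℕ))} {A B D : Finset (Fin k → ℕ)}
  {w x y z : Fin k → ℕ}

/-- `y` is reachable from `x` along edges of `Θ` whose targets lie in `D`. -/
def Reach (Θ : Set ((Fin k → ℕ) × (Fin k → ℕ))) (D : Finset (Fin k → ℕ)) :
    (Fin k → ℕ) → (Fin k → ℕ) → Prop :=
  Relation.ReflTransGen fun a b => b ∈ D ∧ (a, b) ∈ Θ

/-- `w` has no out-neighbour in `D`. -/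
def IsSink (Θ : Set ((Fin k → ℕ) × (Fin k → ℕ))) (D : Finset (Fin k → ℕ))
    (w : Fin k → ℕ) : Prop :=
  ∀ y ∈ D, (w, y) ∉ Θ

theorem Reach.mem (h : Reach Θ D x y) (hx : x ∈ D) : y ∈ D := by
  cases h with
  | refl => exact hx
  | tail _ h => exact h.1

theorem Reach.vmax_le (hΘ : Downward Θ) (h : Reach Θ D x y) : vmax y ≤ vmax x := by
  induction h with
  | refl => exact le_rfl
  | tail _ h ih => exact (hΘ _ h.2).le.trans ih

theorem Reach.vmax_lt (hΘ : Downward Θ) (h : Reach Θ D x y) (hne : x ≠ y) :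
    vmax y < vmax x := by
  cases h with
  | refl => exact absurd rfl hne
  | tail h_alt h => exact (hΘ _ h.2).trans_le (Reach.vmax_le hΘ h_alt)

/-- Reachability from `x` in `A` persists in `B` when `A_x ⊆ B`. -/
theorem Reach.mono (hΘ : Downward Θ) (hAB : ∀ z ∈ A, vmax z < vmax x → z ∈ B)
    (h : Reach Θ A x y) : Reach Θ B x y := by
  induction h with
  | refl => exact .refl
  | tail h_alt h ih =>
    exact ih.tail ⟨hAB _ h.1 ((hΘ _ h.2).trans_le (Reach.vmax_le hΘ h_alt)), h.2⟩

theorem exists_reach_isSink (hΘ : Downward Θ) (D : Finset (Fin k → ℕ)) (x : Fin k → ℕ) :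
    ∃ w, Reach Θ D x w ∧ IsSink Θ D w := by
  induction hn : vmax x using Nat.strong_induction_on generalizing x with
  | _ n ih =>
    by_cases hx : IsSink Θ D x
    · exact ⟨x, .refl, hx⟩
    · obtain ⟨y, hy, hxy⟩ : ∃ y ∈ D, (x, y) ∈ Θ := by simpa [IsSink] using hx
      obtain ⟨w, hw, hws⟩ := ih _ (hn ▸ hΘ _ hxy) y rfl
      exact ⟨w, hw.head ⟨hy, hxy⟩, hws⟩

theorem isPath_iff (hΘ : Downward Θ) {l : List (Fin k → ℕ)} :
    IsPath Θ D l ↔ l ≠ [] ∧ (∀ x ∈ l, x ∈ D) ∧ l.IsChain fun a b => (a, b) ∈ Θ := by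
  refine ⟨fun h => ⟨h.1, h.2.2.1, h.2.2.2⟩, fun h => ⟨h.1, ?_, h.2.1, h.2.2⟩⟩
  have hc : l.IsChain (Function.onFun (· > ·) vmax) := h.2.2.imp fun _ _ hab => hΘ _ hab
  have : IsTrans (Fin k → ℕ) (Function.onFun (· > ·) vmax) :=
    ⟨fun _ _ _ (h₁ : _ > _) (h₂ : _ > _) => gt_trans h₁ h₂⟩
  refine (List.isChain_iff_pairwise.1 hc).imp ?_
  rintro a b (hab : vmax a > vmax b) rfl
  exact lt_irrefl _ hab

theorem isTerminalPath_iff (hΘ : Downward Θ) {l : List (Fin k → ℕ)} (hw : l.getLast? = some w) :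
    IsTerminalPath Θ D l ↔ IsPath Θ D l ∧ IsSink Θ D w := by
  refine and_congr_right fun hl => forall_congr' fun y => ?_
  rw [isPath_iff hΘ] at hl ⊢
  rw [List.isChain_append]
  simp only [hw, Option.mem_def, Option.some.injEq, List.head?_cons, forall_eq',
    List.mem_append, List.mem_singleton, List.isChain_singleton, hl.2.2, true_and, ne_eq,
    List.append_eq_nil_iff, List.cons_ne_nil, and_false, not_false_eq_true]
  constructor
  · intro h hy hwy
    exact h ⟨fun x hx => hx.elim (hl.2.1 x) fun hxy => hxy ▸ hy, hwy⟩
  · rintro h ⟨hmem, hwy⟩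
    exact h (hmem y (Or.inr rfl)) hwy

theorem reach_of_isChain {l : List (Fin k → ℕ)} (hmem : ∀ x ∈ l, x ∈ D)
    (hc : l.IsChain fun a b => (a, b) ∈ Θ) (hz : l.head? = some z) (hw : l.getLast? = some w) :
    Reach Θ D z w := by
  induction l generalizing z with
  | nil => simp at hz
  | cons a l ih =>
    obtain rfl : a = z := by simpa using hz
    cases l with
    | nil =>
      obtain rfl : a = w := by simpa using hw
      exact .refl
    | cons b l =>
      rw [List.isChain_cons_cons] at hc
      exact (ih (fun x hx => hmem x (List.mem_cons_of_mem _ hx)) hc.2 rfl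
        (by simpa using hw)).head ⟨hmem b (by simp), hc.1⟩

theorem Reach.exists_isChain (hz : z ∈ D) (h : Reach Θ D z w) :
    ∃ l : List (Fin k → ℕ), (∀ x ∈ l, x ∈ D) ∧ (l.IsChain fun a b => (a, b) ∈ Θ) ∧
      l.head? = some z ∧ l.getLast? = some w := by
  induction h with
  | refl => exact ⟨[z], by simpa using hz, by simp, rfl, rfl⟩
  | @tail b c _ hbc ih =>
    obtain ⟨l, hmem, hc, hhead, hlast⟩ := ih
    refine ⟨l ++ [c], ?_, ?_, ?_, ?_⟩
    · intro x hx
      rcases List.mem_append.1 hx with hx | hx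
      · exact hmem x hx
      · exact (List.mem_singleton.1 hx) ▸ hbc.1
    · rw [List.isChain_append]
      simpa [hlast, hc] using hbc.2
    · simp [hhead]
    · simp

theorem mem_TD_iff (hΘ : Downward Θ) :
    w ∈ TD Θ D z ↔ z ∈ D ∧ Reach Θ D z w ∧ IsSink Θ D w := by
  constructor
  · rintro ⟨l, hl, hhead, hlast⟩
    obtain ⟨hp, hs⟩ := (isTerminalPath_iff hΘ hlast).1 hl
    exact ⟨hp.2.2.1 z (List.mem_of_head? hhead),
      reach_of_isChain hp.2.2.1 hp.2.2.2 hhead hlast, hs⟩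
  · rintro ⟨hz, hr, hs⟩
    obtain ⟨l, hmem, hc, hhead, hlast⟩ := hr.exists_isChain hz
    refine ⟨l, (isTerminalPath_iff hΘ hlast).2 ⟨(isPath_iff hΘ).2 ⟨?_, hmem, hc⟩, hs⟩,
      hhead, hlast⟩
    rintro rfl
    simp at hhead

theorem tD_le_vmin (Θ : Set ((Fin k → ℕ) × (Fin k → ℕ))) (D : Finset (Fin k → ℕ))
    (z : Fin k → ℕ) : tD Θ D z ≤ vmin z :=
  Nat.sInf_le (Or.inr rfl)

theorem tD_le_of_mem_TD (h : w ∈ TD Θ D z) : tD Θ D z ≤ vmin w :=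
  Nat.sInf_le (Or.inl ⟨w, h, rfl⟩)

theorem tD_eq_or (Θ : Set ((Fin k → ℕ) × (Fin k → ℕ))) (D : Finset (Fin k → ℕ))
    (z : Fin k → ℕ) : tD Θ D z = vmin z ∨ ∃ w ∈ TD Θ D z, tD Θ D z = vmin w := by
  rcases Nat.sInf_mem (s := vmin '' TD Θ D z ∪ {vmin z}) ⟨_, Or.inr rfl⟩ with ⟨w, hw, h⟩ | h
  · exact Or.inr ⟨w, hw, h.symm⟩
  · exact Or.inl h

theorem isTerminalPath_singleton_iff (hΘ : Downward Θ) (hz : z ∈ D) :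
    IsTerminalPath Θ D [z] ↔ IsSink Θ D z := by
  rw [isTerminalPath_iff hΘ rfl, isPath_iff hΘ]
  simp [hz]

theorem tDhat_of_isSink (hΘ : Downward Θ) (hz : z ∈ D) (h : IsSink Θ D z) :
    tDhat Θ D z = vmax z :=
  if_pos ((isTerminalPath_singleton_iff hΘ hz).2 h)

theorem tDhat_of_not_isSink (hΘ : Downward Θ) (hz : z ∈ D) (h : ¬ IsSink Θ D z) :
    tDhat Θ D z = tD Θ D z :=
  if_neg (mt (isTerminalPath_singleton_iff hΘ hz).1 h)

theorem tD_of_isSink (hΘ : Downward Θ) (h : IsSink Θ D z) : tD Θ D z = vmin z := by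
  rcases tD_eq_or Θ D z with h_alt | ⟨w, hw, h_alt⟩
  · exact h_alt
  · obtain ⟨-, hr, -⟩ := (mem_TD_iff hΘ).1 hw
    rcases Relation.ReflTransGen.cases_head hr with rfl | ⟨c, hc, -⟩
    · exact h_alt
    · exact absurd hc.2 (h c hc.1)

/-- The family of all relaxed terminal label functions. -/
def tDhatFam (Θ : Set ((Fin k → ℕ) × (Fin k → ℕ))) :
    Set (Finset (Fin k → ℕ) × ((Fin k → ℕ) → ℕ)) :=
  Set.range fun D => (D, tDhat Θ D)

theorem fullFam_tDhatFam (Θ : Set ((Fin k → ℕ) × (Fin k → ℕ))) : FullFam (tDhatFam Θ) :=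
  fun D => ⟨tDhat Θ D, D, rfl⟩

variable [NeZero k]

theorem tDhat_le_vmax (Θ : Set ((Fin k → ℕ) × (Fin k → ℕ))) (D : Finset (Fin k → ℕ))
    (z : Fin k → ℕ) : tDhat Θ D z ≤ vmax z := by
  unfold tDhat
  split_ifs
  · exact le_rfl
  · exact (tD_le_vmin Θ D z).trans (vmin_le_vmax z)

/-- A vertex of `D` whose relaxed label is its maximum is a sink: otherwise a terminal vertex
strictly below it would give a smaller label. -/
theorem isSink_of_tDhat_eq_vmax (hΘ : Downward Θ) (hz : z ∈ D) (h : tDhat Θ D z = vmax z) :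
    IsSink Θ D z := by
  by_contra hs
  rw [tDhat_of_not_isSink hΘ hz hs] at h
  obtain ⟨w, hw, hws⟩ := exists_reach_isSink hΘ D z
  have hlt : vmax w < vmax z := hw.vmax_lt hΘ fun hzw => hs (hzw ▸ hws)
  have hle : tD Θ D z ≤ vmin w := tD_le_of_mem_TD ((mem_TD_iff hΘ).2 ⟨hz, hw, hws⟩)
  have := vmin_le_vmax w
  omega

theorem reflexiveFam_tDhatFam (hΘ : Downward Θ) : ReflexiveFam (tDhatFam Θ) := by
  rintro _ ⟨D, rfl⟩ x hx
  change x ∈ D at hx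
  change ∃ y ∈ D, ∃ i, tDhat Θ D x = y i
  by_cases hs : IsSink Θ D x
  · rw [tDhat_of_isSink hΘ hx hs]
    exact ⟨x, hx, exists_vmax_eq x⟩
  · rw [tDhat_of_not_isSink hΘ hx hs]
    rcases tD_eq_or Θ D x with h | ⟨w, hw, h⟩
    · exact ⟨x, hx, h ▸ exists_vmin_eq x⟩
    · exact ⟨w, ((mem_TD_iff hΘ).1 hw).2.1.mem hx, h ▸ exists_vmin_eq w⟩

theorem jumpFreeFam_tDhatFam (hΘ : Downward Θ) : JumpFreeFam (tDhatFam Θ) := by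
  rintro _ ⟨A, rfl⟩ _ ⟨B, rfl⟩ x hxA hxB hAB hfg
  dsimp only at hxA hxB hAB hfg ⊢
  by_cases hsA : IsSink Θ A x
  · rw [tDhat_of_isSink hΘ hxA hsA]
    exact tDhat_le_vmax Θ B x
  have hsB : ¬ IsSink Θ B x := fun h => hsA fun y hy hxy => h y (hAB y hy (hΘ _ hxy)) hxy
  rw [tDhat_of_not_isSink hΘ hxA hsA, tDhat_of_not_isSink hΘ hxB hsB]
  rcases tD_eq_or Θ A x with h | ⟨w, hw, h⟩
  · exact h ▸ tD_le_vmin Θ B x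
  obtain ⟨-, hr, hws⟩ := (mem_TD_iff hΘ).1 hw
  have hwA : w ∈ A := hr.mem hxA
  have hlt : vmax w < vmax x := hr.vmax_lt hΘ fun hxw => hsA (hxw ▸ hws)
  have hwB : IsSink Θ B w := isSink_of_tDhat_eq_vmax hΘ (hAB w hwA hlt) (by
    rw [← hfg w hwA hlt, tDhat_of_isSink hΘ hwA hws])
  rw [h]
  exact tD_le_of_mem_TD ((mem_TD_iff hΘ).2 ⟨hxB, hr.mono hΘ hAB, hwB⟩)

/-- Regressive regularity passes from the relaxed label function to the label function. -/
theorem RegressivelyRegular.tD_of_tDhat (hΘ : Downward Θ) {E : Finset ℕ} (hE : cube k E ⊆ D)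
    (h : RegressivelyRegular E (tDhat Θ D)) : RegressivelyRegular E (tD Θ D) := by
  intro x hx
  refine (h x hx).imp (fun hge y hy hxy => ?_) fun heq y hy z hz hxy hxz => ?_
  · by_cases hs : IsSink Θ D y
    · exact (tD_of_isSink hΘ hs).ge
    · exact tDhat_of_not_isSink hΘ (hE hy) hs ▸ hge y hy hxy
  · have hnot : ∀ u ∈ cube k E, SameOrderType x u → tDhat Θ D u = tD Θ D u := fun u hu hxu => by
      refine tDhat_of_not_isSink hΘ (hE hu) fun hs => ?_
      have hlt := (heq u hu u hu hxu hxu).2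
      rw [tDhat_of_isSink hΘ (hE hu) hs] at hlt
      have hmem : u 0 ∈ (E : Set ℕ) := Fintype.mem_piFinset.1 hu 0
      exact absurd ((Nat.sInf_le hmem).trans (le_vmax u 0)) (not_le.2 hlt)
    rw [← hnot y hy hxy, ← hnot z hz hxz]
    exact heq y hy z hz hxy hxz

end Terminal

/-- Multiverse TL (Theorem 2.6): assuming the jump-free theorem, for every downward
directed lattice graph `G = (ℕ^k, Θ)` and every `p > 0` there are a finite `D ⊆ ℕ^k` and
`E ⊆ ℕ` with `|E| = p`, `E^k ⊆ D`, such that `t_D` is regressively regular over `E^k`;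
in particular the set of `t_D`-significant labels of `E^k` has at most `k^k` elements. -/
theorem multiverse_TL {k : ℕ} (hk : 2 ≤ k) (hJF : JumpFreeTheorem k)
    (Θ : Set ((Fin k → ℕ) × (Fin k → ℕ))) (hΘ : Downward Θ)
    (p : ℕ) (hp : 0 < p) :
    ∃ (D : Finset (Fin k → ℕ)) (E : Finset ℕ),
      E.card = p ∧ cube k E ⊆ D ∧
      RegressivelyRegular E (tD Θ D) ∧
      (sigLabels (tD Θ D) (cube k E : Set (Fin k → ℕ))).ncard ≤ k ^ k := by
  have : NeZero k := ⟨by omega⟩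
  obtain ⟨_, E, _, ⟨D, hD⟩, hcard, hE, hreg⟩ := hJF (tDhatFam Θ) (fullFam_tDhatFam Θ)
    (reflexiveFam_tDhatFam hΘ) (jumpFreeFam_tDhatFam hΘ) p hp
  obtain ⟨rfl, rfl⟩ := Prod.mk.inj hD
  have h := hreg.tD_of_tDhat hΘ hE
  exact ⟨D, E, hcard, hE, h, h.ncard_sigLabels_le⟩

end LatticeMultiverse
end

section
/- Let G = (N^k, Θ) be a downward directed lattice graph equipped with a family ℱ_G of partial selection functions, let D ⊆ N^k be finite, and let E ⊆ N be finite with E^k ⊆ D. If the relaxed function ŝ_D is regressively regular over E^k, then the selection labeling function s_D is regressively regular over E^k. -/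
namespace LatticeMultiverse

theorem sD_eq_vmin_of_Phi_empty {k : ℕ} (Θ : Set ((Fin k → ℕ) × (Fin k → ℕ)))
    (hΘ : Downward Θ) (F : (Fin k → ℕ) → (r : ℕ) → (Fin r → (Fin k → ℕ) × ℕ) → Option ℕ)
    (D : Finset (Fin k → ℕ)) (x : Fin k → ℕ)
    (hx : ¬ (Phi Θ F D (sD Θ hΘ F D) x).Nonempty) : sD Θ hΘ F D x = vmin x := by
  rw [sD]
  exact if_neg hx

theorem sInf_le_vmax_of_mem_cube {k : ℕ} (hk : 0 < k) {E : Finset ℕ} {x : Fin k → ℕ}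
    (hx : x ∈ cube k E) : sInf (E : Set ℕ) ≤ vmax x :=
  (Nat.sInf_le (Finset.mem_coe.2 (Fintype.mem_piFinset.1 hx ⟨0, hk⟩))).trans
    (le_csSup (Set.finite_range x).bddAbove (Set.mem_range_self _))

/-- If the relaxed function `ŝ_D` is regressively regular over `E^k`, then so is the
selection labeling function `s_D`. -/
theorem sD_regressivelyRegular_of_sDhat {k : ℕ} (hk : 2 ≤ k)
    (Θ : Set ((Fin k → ℕ) × (Fin k → ℕ))) (hΘ : Downward Θ)
    (F : (Fin k → ℕ) → (r : ℕ) → (Fin r → (Fin k → ℕ) × ℕ) → Option ℕ)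
    (hF : IsSelectionFamily Θ F)
    (D : Finset (Fin k → ℕ)) (E : Finset ℕ) (hE : cube k E ⊆ D)
    (h : RegressivelyRegular E (sDhat Θ hΘ F D)) :
    RegressivelyRegular E (sD Θ hΘ F D) := by
  intro x hx
  refine (h x hx).imp (fun h1 y hy hxy => ?_) (fun h2 => ?_)
  · by_cases hne : (Phi Θ F D (sD Θ hΘ F D) y).Nonempty
    · simpa only [sDhat, if_pos hne] using h1 y hy hxy
    · exact (sD_eq_vmin_of_Phi_empty Θ hΘ F D y hne).ge
  · have hs : ∀ y ∈ cube k E, SameOrderType x y → sDhat Θ hΘ F D y = sD Θ hΘ F D y := by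
      intro y hy hxy
      by_cases hne : (Phi Θ F D (sD Θ hΘ F D) y).Nonempty
      · exact if_pos hne
      · have hlt := (h2 y hy y hy hxy hxy).2
        rw [sDhat, if_neg hne] at hlt
        exact absurd (sInf_le_vmax_of_mem_cube (by omega) hy) hlt.not_ge
    intro y hy z hz hxy hxz
    rw [← hs y hy hxy, ← hs z hz hxz]
    exact h2 y hy z hz hxy hxz

end LatticeMultiverse
end
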